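/- arXiv:0910.4653 — 2 statements merged into one kernel-verified Lean document; each statement's English description precedes it below -/
import Mathlib

section
/- For every ε > 0 there exists a constant C > 0 such that for all f, g, h whose spacetime Fourier transforms f̂, ĝ, ĥ are nonnegative, the following three estimates hold (with ξ = ξ₁+ξ₂): (i) I_{m}(f̂,ĝ,ĥ) ≤ C ‖f‖_{L²(ℝ²)} ‖g‖_{X_{0,1/2+ε}} ‖h‖_{Y_{0,1/2+ε}} with weight m(ξ₁,ξ₂) = |3ξ₂² + 2ξ₁|^{1/2}; (ii) I_{m}(f̂,ĝ,ĥ) ≤ C ‖f‖_{X_{0,1/2+ε}} ‖g‖_{L²(ℝ²)} ‖h‖_{Y_{0,1/2+ε}} with weight m(ξ₁,ξ₂) = |3ξ₂² + 2ξ|^{1/2}; (iii) I_{m}(f̂,ĝ,ĥ) ≤ C ‖f‖_{X_{0,1/2+ε}} ‖g‖_{X_{0,1/2+ε}} ‖h‖_{L²(ℝ²)} with weight m(ξ₁,ξ₂) = |ξ₂|^{1/2}. -/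
open MeasureTheory Real Set
open scoped ENNReal NNReal

noncomputable section

/-- Spacetime Fourier transform of `f : ℝ × ℝ → ℂ` (`p.1` = space frequency ξ, `p.2` = time frequency τ). -/
def FT2 (f : ℝ × ℝ → ℂ) : ℝ × ℝ → ℂ :=
  fun p => ∫ q : ℝ × ℝ,
    Complex.exp (-(2 * Real.pi * (q.1 * p.1 + q.2 * p.2)) * Complex.I) • f q

/-- Japanese bracket `⟨a⟩ = (1+a²)^{1/2}`. -/
def jb (a : ℝ) : ℝ := Real.sqrt (1 + a ^ 2)

/-- The Bourgain norm `‖f‖_{X_{s,b}(φ)}`, as an `ℝ≥0∞`-valued quantity. -/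
def XNorm (φ : ℝ → ℝ) (s b : ℝ) (f : ℝ × ℝ → ℂ) : ℝ≥0∞ :=
  (∫⁻ p : ℝ × ℝ,
    ENNReal.ofReal (jb p.1 ^ (2 * s) * jb (p.2 + φ p.1) ^ (2 * b) * ‖FT2 f p‖ ^ 2)) ^ (1/2 : ℝ)

/-- Schrödinger phase `φ(ξ) = ξ²`. -/
def SchPhase : ℝ → ℝ := fun ξ => ξ ^ 2

/-- Conjugate Schrödinger phase `φ(ξ) = -ξ²`. -/
def SchPhaseNeg : ℝ → ℝ := fun ξ => -ξ ^ 2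

/-- Airy (KdV) phase `φ(ξ) = -ξ³`. -/
def AiryPhase : ℝ → ℝ := fun ξ => -ξ ^ 3

/-- `f` has a nonnegative (real-valued) spacetime Fourier transform. -/
def HasNonnegFT (f : ℝ × ℝ → ℂ) : Prop :=
  ∀ p, (FT2 f p).im = 0 ∧ 0 ≤ (FT2 f p).re

/-- The weighted trilinear functional `I_m(f̂,ĝ,ĥ)`, applied here directly to
the Fourier transforms `F = f̂`, `G = ĝ`, `H = ĥ` (assumed nonnegative). -/
def Itri (m : ℝ → ℝ → ℝ) (F G H : ℝ × ℝ → ℂ) : ℝ≥0∞ :=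
  ∫⁻ q : (ℝ × ℝ) × (ℝ × ℝ),
    ENNReal.ofReal
      (m q.1.1 q.2.1 * (F (q.1.1 + q.2.1, q.1.2 + q.2.2)).re * (G q.1).re * (H q.2).re)

/-- Partial derivative in the spatial variable `x` (first coordinate). -/
def partialX (f : ℝ × ℝ → ℂ) : ℝ × ℝ → ℂ :=
  fun p => deriv (fun x => f (x, p.2)) p.1

/-- Multiplication by the rescaled time cutoff, `(ψ(t/δ)f)(x,t) = ψ(t/δ) f(x,t)`. -/
def timeCut (ψ : ℝ → ℝ) (δ : ℝ) (f : ℝ × ℝ → ℂ) : ℝ × ℝ → ℂ :=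
  fun p => (ψ (p.2 / δ) : ℂ) * f p

/-- `ψ` is a fixed even smooth bump, `0 ≤ ψ ≤ 1`, `ψ ≡ 1` on `[-1,1]`, supp ψ ⊆ `[-2,2]`. -/
def IsTimeBump (ψ : ℝ → ℝ) : Prop :=
  ContDiff ℝ (⊤ : ℕ∞) ψ ∧ HasCompactSupport ψ ∧ (∀ t, ψ (-t) = ψ t) ∧
  (∀ t, 0 ≤ ψ t ∧ ψ t ≤ 1) ∧ (∀ t ∈ Set.Icc (-1 : ℝ) 1, ψ t = 1) ∧
  Function.support ψ ⊆ Set.Icc (-2 : ℝ) 2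

/-- `m` is an admissible symbol `m_{N,s}` for the smoothing operator `I_{N,s}`. -/
def IsISymbol (N s : ℝ) (m : ℝ → ℝ) : Prop :=
  ContDiff ℝ (⊤ : ℕ∞) m ∧ (∀ ξ, m (-ξ) = m ξ) ∧
  (∀ ξ, 0 < m ξ ∧ m ξ ≤ 1) ∧
  (∀ ξ η, |ξ| ≤ |η| → m η ≤ m ξ) ∧
  (∀ ξ, |ξ| ≤ N → m ξ = 1) ∧
  (∀ ξ, 2 * N ≤ |ξ| → m ξ = N ^ (1 - s) * |ξ| ^ (s - 1))

/-- Inverse spacetime Fourier transform. -/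
def invFT2 (f : ℝ × ℝ → ℂ) : ℝ × ℝ → ℂ :=
  fun p => ∫ q : ℝ × ℝ,
    Complex.exp ((2 * Real.pi * (q.1 * p.1 + q.2 * p.2)) * Complex.I) • f q

/-- The Fourier multiplier operator (in `x`) with symbol `m(ξ)`. -/
def Iop (m : ℝ → ℝ) (f : ℝ × ℝ → ℂ) : ℝ × ℝ → ℂ :=
  invFT2 (fun q => (m q.1 : ℂ) * FT2 f q)

/-- The restricted Bourgain norm `‖f‖_{X^E_{s,b}(φ)}`. -/
def XRestNorm (φ : ℝ → ℝ) (s b : ℝ) (E : Set ℝ) (f : ℝ × ℝ → ℂ) : ℝ≥0∞ :=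
  ⨅ F ∈ {F : ℝ × ℝ → ℂ | XNorm φ s b F < ⊤ ∧ ∀ x t, t ∈ E → F (x, t) = f (x, t)},
    XNorm φ s b F


open FourierTransform SchwartzMap in
theorem planch_aux {E : Type*} [NormedAddCommGroup E] [InnerProductSpace ℝ E]
    [FiniteDimensional ℝ E] [MeasurableSpace E] [BorelSpace E]
    (f : E → ℂ) (h1 : Integrable f) (h2 : MemLp f 2 volume) :
    eLpNorm (𝓕 f) 2 volume = eLpNorm f 2 volume := by
  have hc : Continuous (𝓕 f) :=
    VectorFourier.fourierIntegral_continuous Real.continuous_fourierChar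
      (by exact continuous_inner) h1
  let f2 : Lp ℂ 2 (volume : Measure E) := h2.toLp f
  have hae : ∀ᵐ x, (𝓕 f2 : Lp ℂ 2 (volume : Measure E)) x = 𝓕 f x := by
    apply ae_eq_of_integral_contDiff_smul_eq
    · exact (Lp.memLp _).locallyIntegrable (by norm_num)
    · exact hc.locallyIntegrable
    · intro g g_smooth g_cpt
      have hg₁ : HasCompactSupport (Complex.ofRealCLM ∘ g) := g_cpt.comp_left rfl
      have hg₂ : ContDiff ℝ (⊤ : ℕ∞) (Complex.ofRealCLM ∘ g) := by fun_prop
      let G := hg₁.toSchwartzMap hg₂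
      have e1 : ∫ x, g x • (𝓕 f2 : Lp ℂ 2 (volume : Measure E)) x
          = Lp.toTemperedDistribution (𝓕 f2 : Lp ℂ 2 (volume : Measure E)) G := by simp [G]
      rw [e1, ← Lp.fourier_toTemperedDistribution_eq, TemperedDistribution.fourier_apply,
        Lp.toTemperedDistribution_apply]
      have e2 : ∫ x, (𝓕 G) x • f2 x = ∫ x, (𝓕 G) x • f x := by
        apply integral_congr_ae
        filter_upwards [h2.coeFn_toLp] with x hx
        rw [hx]
      rw [e2]
      have e3 := VectorFourier.integral_fourierIntegral_smul_eq_flip (L := innerₗ E)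
        (μ := volume) (ν := volume) (f := (G : E → ℂ)) (g := f)
        Real.continuous_fourierChar (by exact continuous_inner) G.integrable h1
      rw [flip_innerₗ] at e3
      rw [SchwartzMap.fourier_coe]
      refine e3.trans ?_
      apply integral_congr_ae
      filter_upwards with x
      simp [G]
      left; rfl
  rw [← eLpNorm_congr_ae hae, ← eLpNorm_congr_ae h2.coeFn_toLp]
  have := Lp.norm_fourier_eq f2
  rw [Lp.norm_def, Lp.norm_def, ENNReal.toReal_eq_toReal_iff' (Lp.eLpNorm_ne_top _) (Lp.eLpNorm_ne_top _)] at this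
  exact this

open FourierTransform in
theorem FT2_eq (f : ℝ × ℝ → ℂ) (p : ℝ × ℝ) :
    FT2 f p = 𝓕 (fun x : WithLp 2 (ℝ × ℝ) => f (WithLp.ofLp x)) (WithLp.toLp 2 p) := by
  rw [Real.fourier_eq', FT2]
  rw [← (WithLp.volume_preserving_ofLp ℝ ℝ).integral_comp (MeasurableEquiv.toLp 2 (ℝ × ℝ)).symm.measurableEmbedding]
  congr 1
  ext x
  congr 2
  simp
  ring

theorem FT2_zero (f : ℝ × ℝ → ℂ) (hf : ¬ Integrable f) (p : ℝ × ℝ) : FT2 f p = 0 := by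
  refine integral_undef fun h => hf ?_
  have h' := h.bdd_smul 1 (φ := fun q : ℝ × ℝ => Complex.exp ((2 * Real.pi * (q.1 * p.1 + q.2 * p.2)) * Complex.I)) (by
      apply Continuous.aestronglyMeasurable; fun_prop) (by
      filter_upwards with q
      have := Complex.norm_exp_ofReal_mul_I (2 * Real.pi * (q.1 * p.1 + q.2 * p.2))
      push_cast at this
      exact this.le)
  convert h' using 1
  ext q
  simp [← mul_assoc, ← Complex.exp_add]

theorem FT2_cont (f : ℝ × ℝ → ℂ) : Continuous (FT2 f) := by
  by_cases hf : Integrable f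
  · have h1 : Integrable (fun x : WithLp 2 (ℝ × ℝ) => f (WithLp.ofLp x)) :=
      ((WithLp.volume_preserving_ofLp ℝ ℝ).integrable_comp_emb
        (MeasurableEquiv.toLp 2 (ℝ × ℝ)).symm.measurableEmbedding).2 hf
    have hc := VectorFourier.fourierIntegral_continuous (L := innerₗ (WithLp 2 (ℝ × ℝ)))
      Real.continuous_fourierChar (by exact continuous_inner) h1
    rw [show FT2 f = _ from funext (FT2_eq f)]
    exact hc.comp (WithLp.prod_continuous_toLp 2 ℝ ℝ)
  · have : FT2 f = fun _ => 0 := funext (FT2_zero f hf)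
    rw [this]; exact continuous_const

theorem FT2_planch (f : ℝ × ℝ → ℂ) :
    ∫⁻ p, ‖FT2 f p‖ₑ ^ 2 ≤ eLpNorm f 2 volume ^ 2 := by
  by_cases hf : Integrable f
  · by_cases h2 : MemLp f 2 volume
    · have hm := WithLp.volume_preserving_ofLp ℝ ℝ
      have he := (MeasurableEquiv.toLp 2 (ℝ × ℝ)).symm.measurableEmbedding
      have h1 : Integrable (fun x : WithLp 2 (ℝ × ℝ) => f (WithLp.ofLp x)) :=
        (hm.integrable_comp_emb he).2 hf
      have := planch_aux _ h1 (h2.comp_measurePreserving hm)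
      have e2 : eLpNorm (fun x : WithLp 2 (ℝ × ℝ) => f (WithLp.ofLp x)) 2 volume = eLpNorm f 2 volume :=
        eLpNorm_comp_measurePreserving h2.1 hm
      have e3 : eLpNorm (fun x : WithLp 2 (ℝ × ℝ) => FT2 f (WithLp.ofLp x)) 2 volume = eLpNorm (FT2 f) 2 volume :=
        eLpNorm_comp_measurePreserving (FT2_cont f).aestronglyMeasurable hm
      have e4 : FourierTransform.fourier (fun x : WithLp 2 (ℝ × ℝ) => f (WithLp.ofLp x))
          = (fun x : WithLp 2 (ℝ × ℝ) => FT2 f (WithLp.ofLp x)) := by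
        ext x
        rw [FT2_eq, WithLp.toLp_ofLp]
      have this' := this.symm.trans ((congrArg (fun u => eLpNorm u 2 volume) e4).trans e3)
      rw [← e2]
      erw [this']
      rw [eLpNorm_eq_lintegral_rpow_enorm_toReal (by norm_num) (by norm_num), ← ENNReal.rpow_natCast,
        ← ENNReal.rpow_mul]
      simp
    · have : eLpNorm f 2 volume = ⊤ := by
        by_contra h
        exact h2 ⟨hf.1, lt_top_iff_ne_top.2 h⟩
      rw [this]; simp
  · have : ∀ p, FT2 f p = 0 := FT2_zero f hf
    simp [this]

theorem oneD (φ φ' : ℝ → ℝ) (hd : ∀ x, HasDerivAt φ (φ' x) x) (S : Fin 3 → Set ℝ)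
    (hS : ∀ i, MeasurableSet (S i)) (hi : ∀ i, InjOn φ (S i))
    (hcov : ∀ x, φ' x ≠ 0 → ∃ i, x ∈ S i) (u : ℝ → ℝ≥0∞) :
    ∫⁻ x, ENNReal.ofReal |φ' x| * u (φ x) ≤ 3 * ∫⁻ x, u x := by
  have h1 : ∫⁻ x, ENNReal.ofReal |φ' x| * u (φ x)
      ≤ ∫⁻ x in ⋃ i, S i, ENNReal.ofReal |φ' x| * u (φ x) := by
    rw [← lintegral_indicator (MeasurableSet.iUnion hS)]
    apply lintegral_mono
    intro x
    by_cases hx : φ' x = 0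
    · simp [hx]
    · have : x ∈ ⋃ i, S i := mem_iUnion.2 (hcov x hx)
      simp [indicator_of_mem this]
  refine h1.trans ((lintegral_iUnion_le _ _).trans ?_)
  rw [tsum_fintype]
  calc ∑ i, ∫⁻ x in S i, ENNReal.ofReal |φ' x| * u (φ x)
      ≤ ∑ i : Fin 3, ∫⁻ x, u x := by
        apply Finset.sum_le_sum
        intro i _
        rw [← lintegral_image_eq_lintegral_abs_deriv_mul (hS i)
          (fun x _ => (hd x).hasDerivWithinAt) (hi i)]
        exact setLIntegral_le_lintegral _ _
    _ = 3 * ∫⁻ x, u x := by simp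

theorem oneD_cubic (k a b e : ℝ) (hk : k ≠ 0) (u : ℝ → ℝ≥0∞) :
    ∫⁻ x, ENNReal.ofReal |k * (3 * x ^ 2 + 2 * a * x + b)| * u (k * (x ^ 3 + a * x ^ 2 + b * x) + e)
      ≤ 3 * ∫⁻ x, u x := by
  have key : ∀ x y : ℝ, k * (x ^ 3 + a * x ^ 2 + b * x) + e = k * (y ^ 3 + a * y ^ 2 + b * y) + e →
      x ≠ y → x ^ 2 + x * y + y ^ 2 + a * (x + y) + b = 0 := by
    intro x y h hxy
    have h2 : k * ((x - y) * (x ^ 2 + x * y + y ^ 2 + a * (x + y) + b)) = 0 := by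
      linear_combination h
    simpa [hk, sub_ne_zero.2 hxy] using h2
  refine oneD (fun x => k * (x ^ 3 + a * x ^ 2 + b * x) + e)
    (fun x => k * (3 * x ^ 2 + 2 * a * x + b)) ?_
    ![{x | 0 < 3 * x ^ 2 + 2 * a * x + b ∧ 3 * x + a < 0},
      {x | 0 < 3 * x ^ 2 + 2 * a * x + b ∧ 0 ≤ 3 * x + a},
      {x | 3 * x ^ 2 + 2 * a * x + b < 0}] ?_ ?_ ?_ u
  · intro x
    have := ((((hasDerivAt_pow 3 x).add ((hasDerivAt_pow 2 x).const_mul a)).add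
      ((hasDerivAt_id x).const_mul b)).const_mul k).add_const e
    refine this.congr_deriv ?_
    push_cast
    ring
  · intro i
    fin_cases i
    · exact (isOpen_lt (by fun_prop : Continuous fun _ : ℝ => (0 : ℝ)) (by fun_prop : Continuous fun x : ℝ => 3 * x ^ 2 + 2 * a * x + b)).measurableSet.inter
        (isOpen_lt (by fun_prop : Continuous fun x : ℝ => 3 * x + a) (by fun_prop : Continuous fun _ : ℝ => (0 : ℝ))).measurableSet
    · exact (isOpen_lt (by fun_prop : Continuous fun _ : ℝ => (0 : ℝ)) (by fun_prop : Continuous fun x : ℝ => 3 * x ^ 2 + 2 * a * x + b)).measurableSet.inter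
        (isClosed_le (by fun_prop : Continuous fun _ : ℝ => (0 : ℝ)) (by fun_prop : Continuous fun x : ℝ => 3 * x + a)).measurableSet
    · exact (isOpen_lt (by fun_prop : Continuous fun x : ℝ => 3 * x ^ 2 + 2 * a * x + b) (by fun_prop : Continuous fun _ : ℝ => (0 : ℝ))).measurableSet
  · intro i
    fin_cases i
    · rintro x ⟨hx1, hx2⟩ y ⟨hy1, hy2⟩ h
      by_contra hne
      have h0 := key x y h hne
      rcases lt_or_gt_of_ne hne with hlt | hlt
      · nlinarith [mul_pos (sub_pos.2 hlt) (by linarith : 0 < -(2 * y + x + a))]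
      · nlinarith [mul_pos (sub_pos.2 hlt) (by linarith : 0 < -(2 * x + y + a))]
    · rintro x ⟨hx1, hx2⟩ y ⟨hy1, hy2⟩ h
      by_contra hne
      have h0 := key x y h hne
      rcases lt_or_gt_of_ne hne with hlt | hlt
      · nlinarith [mul_nonneg (sub_pos.2 hlt).le (by linarith : 0 ≤ (2 * x + y + a))]
      · nlinarith [mul_nonneg (sub_pos.2 hlt).le (by linarith : 0 ≤ (2 * y + x + a))]
    · intro x hx y hy h
      by_contra hne
      have h0 := key x y h hne
      have hx' : 3 * x ^ 2 + 2 * a * x + b < 0 := hx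
      have hy' : 3 * y ^ 2 + 2 * a * y + b < 0 := hy
      nlinarith [sq_nonneg (x - y)]
  · intro x hx
    have hx' : 3 * x ^ 2 + 2 * a * x + b ≠ 0 := fun h => hx (by simp [h])
    rcases lt_or_gt_of_ne hx' with h | h
    · exact ⟨2, h⟩
    · rcases lt_or_ge (3 * x + a) 0 with h2 | h2
      · exact ⟨0, h, h2⟩
      · exact ⟨1, h, h2⟩

theorem oneD_lin (k e : ℝ) (u : ℝ → ℝ≥0∞) :
    ∫⁻ x, ENNReal.ofReal |k| * u (2 * k * x + e) ≤ 3 * ∫⁻ x, u x := by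
  by_cases hk : k = 0
  · simp [hk]
  refine le_trans ?_ (oneD (fun x => 2 * k * x + e) (fun _ => 2 * k) ?_ (fun _ => univ)
    (fun _ => MeasurableSet.univ) ?_ (fun x _ => ⟨0, mem_univ _⟩) u)
  · apply lintegral_mono
    intro x
    dsimp only
    refine mul_le_mul_left (ENNReal.ofReal_le_ofReal ?_) _
    rw [abs_mul]
    have := abs_nonneg k
    norm_num
    linarith
  · intro x
    simpa using ((hasDerivAt_id x).const_mul (2 * k)).add_const e
  · intro i x _ y _ h
    simpa [hk] using h

theorem kerB (M : ℝ → ℝ≥0∞) (hM : Measurable M) (w : ℝ → ℝ≥0∞) (hw : Measurable w)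
    (α β : ℝ → ℝ) (hα : Measurable α) (hβ : Measurable β) (c σ : ℝ)
    (h : ∀ e, ∫⁻ x, M x * w (e + (α x - σ * β x)) ≤ 3 * ∫⁻ x, w x) :
    ∫⁻ p : ℝ × ℝ, M p.1 * (w (c + σ * p.2 + α p.1) * w (p.2 + β p.1))
      ≤ 3 * (∫⁻ x, w x) * ∫⁻ x, w x := by
  rw [Measure.volume_eq_prod, lintegral_prod _ (by fun_prop)]
  have h1 : ∀ x, ∫⁻ τ, M x * (w (c + σ * τ + α x) * w (τ + β x))
      = ∫⁻ τ, M x * (w (c + σ * τ + (α x - σ * β x)) * w τ) := by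
    intro x
    rw [← lintegral_add_right_eq_self (fun τ => M x * (w (c + σ * τ + (α x - σ * β x)) * w τ)) (β x)]
    congr 1
    ext τ
    congr 3
    ring
  simp_rw [h1]
  rw [lintegral_lintegral_swap (by fun_prop)]
  calc ∫⁻ τ, ∫⁻ x, M x * (w (c + σ * τ + (α x - σ * β x)) * w τ)
      = ∫⁻ τ, (∫⁻ x, M x * w (c + σ * τ + (α x - σ * β x))) * w τ := by
        congr 1
        ext τ
        rw [← lintegral_mul_const _ (by fun_prop)]
        simp_rw [mul_assoc]
    _ ≤ ∫⁻ τ, (3 * ∫⁻ x, w x) * w τ := by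
        gcongr with τ
        exact h _
    _ = _ := by rw [lintegral_const_mul _ hw]

theorem triCS {Q : Type*} [MeasurableSpace Q] (μ : Measure Q) (m D U V w W : Q → ℝ≥0∞)
    (hm : Measurable m) (hD : Measurable D) (hU : Measurable U) (hV : Measurable V)
    (hw : Measurable w) (hW : Measurable W) (hwW : ∀ q, w q * W q = 1)
    (K N A B : ℝ≥0∞)
    (h1 : ∫⁻ q, D q ^ 2 * (m q ^ 2 * w q) ∂μ ≤ K * N ^ 2)
    (h2 : ∫⁻ q, W q * U q ^ 2 * V q ^ 2 ∂μ = A * B) :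
    ∫⁻ q, m q * D q * U q * V q ∂μ ≤ K ^ (1/2 : ℝ) * N * A ^ (1/2 : ℝ) * B ^ (1/2 : ℝ) := by
  have hs : ∀ x : ℝ≥0∞, (x ^ (1/2 : ℝ)) ^ (2 : ℝ) = x := by
    intro x; rw [← ENNReal.rpow_mul]; norm_num
  have h := ENNReal.lintegral_mul_le_Lp_mul_Lq μ Real.HolderConjugate.two_two
    (f := fun q => D q * m q * w q ^ (1/2 : ℝ)) (g := fun q => W q ^ (1/2 : ℝ) * U q * V q)
    (by fun_prop) (by fun_prop)
  have e : ∀ q, ((fun q => D q * m q * w q ^ (1/2 : ℝ)) * (fun q => W q ^ (1/2 : ℝ) * U q * V q)) q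
      = m q * D q * U q * V q := by
    intro q
    have : w q ^ (1/2 : ℝ) * W q ^ (1/2 : ℝ) = 1 := by
      rw [← ENNReal.mul_rpow_of_nonneg _ _ (by norm_num), hwW, ENNReal.one_rpow]
    calc _ = m q * D q * U q * V q * (w q ^ (1/2 : ℝ) * W q ^ (1/2 : ℝ)) := by
          simp only [Pi.mul_apply]; ring
      _ = _ := by rw [this, mul_one]
  simp_rw [e] at h
  simp_rw [ENNReal.mul_rpow_of_nonneg _ _ (zero_le_two : (0:ℝ) ≤ 2), hs, ENNReal.rpow_two] at h
  rw [h2] at h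
  refine h.trans ?_
  rw [ENNReal.mul_rpow_of_nonneg _ _ (by norm_num), ← mul_assoc]
  gcongr
  calc _ ≤ (K * N ^ 2) ^ (1/2 : ℝ) := by
        gcongr
        refine le_trans (le_of_eq ?_) h1
        congr 1; ext q; ring
    _ = _ := by
        rw [ENNReal.mul_rpow_of_nonneg _ _ (by norm_num), ← ENNReal.rpow_natCast, ← ENNReal.rpow_mul]
        norm_num

theorem XNorm_eq (φ : ℝ → ℝ) (b : ℝ) (g : ℝ × ℝ → ℂ) :
    XNorm φ 0 b g = (∫⁻ p : ℝ × ℝ,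
      ENNReal.ofReal (jb (p.2 + φ p.1) ^ (2 * b)) * ‖FT2 g p‖ₑ ^ 2) ^ (1/2 : ℝ) := by
  rw [XNorm]
  congr 2
  ext p
  rw [mul_zero, Real.rpow_zero, one_mul, ENNReal.ofReal_mul (by unfold jb; positivity),
    ENNReal.ofReal_pow (norm_nonneg _), ofReal_norm]

theorem Itri_eq (m : ℝ → ℝ → ℝ) (f g h : ℝ × ℝ → ℂ) (hm : ∀ x y, 0 ≤ m x y)
    (hf : HasNonnegFT f) (hg : HasNonnegFT g) (hh : HasNonnegFT h) :
    Itri m (FT2 f) (FT2 g) (FT2 h) = ∫⁻ q : (ℝ × ℝ) × (ℝ × ℝ),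
      ENNReal.ofReal (m q.1.1 q.2.1) * ‖FT2 f (q.1 + q.2)‖ₑ * ‖FT2 g q.1‖ₑ * ‖FT2 h q.2‖ₑ := by
  have aux : ∀ (f : ℝ × ℝ → ℂ), HasNonnegFT f → ∀ p, ENNReal.ofReal (FT2 f p).re = ‖FT2 f p‖ₑ := by
    intro f hf p
    have : FT2 f p = ((FT2 f p).re : ℂ) := by
      apply Complex.ext <;> simp [(hf p).1]
    conv_rhs => rw [this]
    rw [← ofReal_norm, Complex.norm_real, Real.norm_of_nonneg (hf p).2]
  rw [Itri]
  congr 1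
  ext q
  rw [ENNReal.ofReal_mul (mul_nonneg (mul_nonneg (hm _ _) (hf _).2) (hg _).2),
    ENNReal.ofReal_mul (mul_nonneg (hm _ _) (hf _).2), ENNReal.ofReal_mul (hm _ _),
    aux f hf, aux g hg, aux h hh]
  rfl

theorem jb_cont : Continuous jb := by unfold jb; fun_prop

theorem jb_pos (a : ℝ) : 0 < jb a := by unfold jb; positivity

theorem jb_int (ε : ℝ) (hε : 0 < ε) :
    ∫⁻ a, ENNReal.ofReal (jb a ^ (-(2 * (1/2 + ε)))) ≠ ⊤ := by
  have h := integrable_rpow_neg_one_add_norm_sq (E := ℝ) (μ := volume) (r := 1 + 2 * ε)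
    (by simp; linarith)
  have h2 := h.lintegral_lt_top
  refine ne_of_lt (lt_of_le_of_lt (le_of_eq ?_) h2)
  congr 1
  ext a
  congr 1
  rw [jb, Real.sqrt_eq_rpow, ← Real.rpow_mul (by positivity)]
  simp only [Real.norm_eq_abs, sq_abs]
  congr 1
  ring

theorem main_i (w W : ℝ → ℝ≥0∞) (hw : Measurable w) (hW : Measurable W)
    (hwW : ∀ a, w a * W a = 1) (F G H : ℝ × ℝ → ℝ≥0∞) (hF : Measurable F) (hG : Measurable G)
    (hH : Measurable H) (N : ℝ≥0∞) :
    (∫⁻ p, F p ^ 2 ≤ N ^ 2 →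
      ∫⁻ q : (ℝ × ℝ) × (ℝ × ℝ), ENNReal.ofReal (|3 * q.2.1 ^ 2 + 2 * q.1.1| ^ ((1:ℝ)/2))
        * F (q.1 + q.2) * G q.1 * H q.2
      ≤ (3 * (∫⁻ x, w x) * ∫⁻ x, w x) ^ (1/2 : ℝ) * N
        * (∫⁻ p : ℝ × ℝ, W (p.2 + SchPhase p.1) * G p ^ 2) ^ (1/2 : ℝ)
        * (∫⁻ p : ℝ × ℝ, W (p.2 + AiryPhase p.1) * H p ^ 2) ^ (1/2 : ℝ)) ∧
    (∫⁻ p, G p ^ 2 ≤ N ^ 2 →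
      ∫⁻ q : (ℝ × ℝ) × (ℝ × ℝ), ENNReal.ofReal (|3 * q.2.1 ^ 2 + 2 * (q.1.1 + q.2.1)| ^ ((1:ℝ)/2))
        * F (q.1 + q.2) * G q.1 * H q.2
      ≤ (3 * (∫⁻ x, w x) * ∫⁻ x, w x) ^ (1/2 : ℝ) * N
        * (∫⁻ p : ℝ × ℝ, W (p.2 + SchPhase p.1) * F p ^ 2) ^ (1/2 : ℝ)
        * (∫⁻ p : ℝ × ℝ, W (p.2 + AiryPhase p.1) * H p ^ 2) ^ (1/2 : ℝ)) ∧
    (∫⁻ p, H p ^ 2 ≤ N ^ 2 →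
      ∫⁻ q : (ℝ × ℝ) × (ℝ × ℝ), ENNReal.ofReal (|q.2.1| ^ ((1:ℝ)/2))
        * F (q.1 + q.2) * G q.1 * H q.2
      ≤ (3 * (∫⁻ x, w x) * ∫⁻ x, w x) ^ (1/2 : ℝ) * N
        * (∫⁻ p : ℝ × ℝ, W (p.2 + SchPhase p.1) * F p ^ 2) ^ (1/2 : ℝ)
        * (∫⁻ p : ℝ × ℝ, W (p.2 + SchPhase p.1) * G p ^ 2) ^ (1/2 : ℝ)) := by
  have hS : Measurable SchPhase := by unfold SchPhase; fun_prop
  have hA : Measurable AiryPhase := by unfold AiryPhase; fun_prop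
  have hsq : ∀ a : ℝ, ENNReal.ofReal (|a| ^ ((1:ℝ)/2)) ^ 2 = ENNReal.ofReal |a| := by
    intro a
    rw [← ENNReal.ofReal_pow (by positivity), ← Real.rpow_natCast, ← Real.rpow_mul (abs_nonneg _)]
    norm_num
  have hww : ∀ a b, w a * w b * (W a * W b) = 1 := by
    intro a b
    calc _ = (w a * W a) * (w b * W b) := by ring
      _ = 1 := by rw [hwW, hwW, one_mul]
  have hshift : ∀ (A B : ℝ × ℝ → ℝ≥0∞), Measurable A → Measurable B →
      ∫⁻ q : (ℝ × ℝ) × (ℝ × ℝ), A (q.1 + q.2) * B q.2 = (∫⁻ p, A p) * ∫⁻ p, B p := by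
    intro A B hA hB
    rw [Measure.volume_eq_prod (ℝ × ℝ) (ℝ × ℝ), lintegral_prod_symm' _ (by fun_prop)]
    rw [← lintegral_const_mul _ hB]
    congr 1
    ext y
    dsimp only
    rw [lintegral_mul_const _ (by fun_prop), lintegral_add_right_eq_self (fun x => A x)]
  have hshift2 : ∀ (A B : ℝ × ℝ → ℝ≥0∞), Measurable A → Measurable B →
      ∫⁻ q : (ℝ × ℝ) × (ℝ × ℝ), A (q.1 + q.2) * B q.1 = (∫⁻ p, A p) * ∫⁻ p, B p := by
    intro A B hA hB
    rw [Measure.volume_eq_prod (ℝ × ℝ) (ℝ × ℝ), lintegral_prod _ (by fun_prop)]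
    rw [← lintegral_const_mul _ hB]
    congr 1
    ext y
    dsimp only
    rw [lintegral_mul_const _ (by fun_prop), lintegral_add_left_eq_self (fun x => A x)]
  have hfin : ∀ (D : ℝ × ℝ → ℝ≥0∞) (k : ℝ × ℝ → ℝ × ℝ → ℝ≥0∞), Measurable D →
      (∀ p, Measurable (k p)) →
      (∀ p, ∫⁻ r, k p r ≤ 3 * (∫⁻ x, w x) * ∫⁻ x, w x) → ∫⁻ p, D p ^ 2 ≤ N ^ 2 →
      ∫⁻ p, ∫⁻ r, D p ^ 2 * k p r ≤ 3 * (∫⁻ x, w x) * (∫⁻ x, w x) * N ^ 2 := by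
    intro D k hD hk hb hN
    calc _ ≤ ∫⁻ p, D p ^ 2 * (3 * (∫⁻ x, w x) * ∫⁻ x, w x) := by
          gcongr with p
          rw [lintegral_const_mul _ (hk p)]
          gcongr
          exact hb p
      _ = (∫⁻ p, D p ^ 2) * (3 * (∫⁻ x, w x) * ∫⁻ x, w x) := by
          rw [lintegral_mul_const _ (by fun_prop)]
      _ ≤ _ := by rw [mul_comm]; gcongr
  refine ⟨fun hN => ?_, fun hN => ?_, fun hN => ?_⟩
  · refine triCS (Q := (ℝ × ℝ) × (ℝ × ℝ)) volume
      (fun q => ENNReal.ofReal (|3 * q.2.1 ^ 2 + 2 * q.1.1| ^ ((1:ℝ)/2))) (fun q => F (q.1 + q.2)) (fun q => G q.1) (fun q => H q.2)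
      (fun q => w (q.1.2 + SchPhase q.1.1) * w (q.2.2 + AiryPhase q.2.1))
      (fun q => W (q.1.2 + SchPhase q.1.1) * W (q.2.2 + AiryPhase q.2.1))
      (by fun_prop) (by fun_prop) (by fun_prop) (by fun_prop) (by fun_prop) (by fun_prop)
      (fun q => hww _ _) _ _ _ _ ?_ ?_
    · simp_rw [hsq]
      rw [Measure.volume_eq_prod (ℝ × ℝ) (ℝ × ℝ), lintegral_prod_symm' _ (by fun_prop)]
      dsimp only
      have : ∀ y : ℝ × ℝ, ∫⁻ x : ℝ × ℝ, F (x + y) ^ 2 * (ENNReal.ofReal |3 * y.1 ^ 2 + 2 * x.1| *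
            (w (x.2 + SchPhase x.1) * w (y.2 + AiryPhase y.1)))
          = ∫⁻ x : ℝ × ℝ, F x ^ 2 * (ENNReal.ofReal |3 * y.1 ^ 2 + 2 * (x.1 - y.1)| *
            (w (x.2 - y.2 + SchPhase (x.1 - y.1)) * w (y.2 + AiryPhase y.1))) := by
        intro y
        rw [← lintegral_sub_right_eq_self _ y]
        simp
      simp_rw [this]
      rw [lintegral_lintegral_swap (by fun_prop)]
      refine hfin F _ hF (fun p => by fun_prop) (fun p => ?_) hN
      have := kerB (fun x => ENNReal.ofReal |3 * x ^ 2 + 2 * (p.1 - x)|) (by fun_prop) w hw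
        (fun x => SchPhase (p.1 - x)) AiryPhase (by fun_prop) hA p.2 (-1) (by
          intro e
          convert oneD_cubic (-1) (-1) (2 * p.1) (e + p.1 ^ 2) (by norm_num) w using 3 with x
          congr 2
          · rw [← abs_neg]; congr 1; ring
          · simp only [SchPhase, AiryPhase]; ring)
      refine le_trans (le_of_eq ?_) this
      congr 1; ext r; congr 4; ring
    · rw [← lintegral_prod_mul (by fun_prop) (by fun_prop)]
      rw [Measure.volume_eq_prod (ℝ × ℝ) (ℝ × ℝ)]
      congr 1; ext q; ring
  · have e0 : ∀ q : (ℝ × ℝ) × (ℝ × ℝ), ENNReal.ofReal (|3 * q.2.1 ^ 2 + 2 * (q.1.1 + q.2.1)| ^ ((1:ℝ)/2))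
        * F (q.1 + q.2) * G q.1 * H q.2 = ENNReal.ofReal (|3 * q.2.1 ^ 2 + 2 * (q.1.1 + q.2.1)| ^ ((1:ℝ)/2))
        * G q.1 * F (q.1 + q.2) * H q.2 := fun q => by ring
    simp_rw [e0]
    refine triCS (Q := (ℝ × ℝ) × (ℝ × ℝ)) volume
      (fun q => ENNReal.ofReal (|3 * q.2.1 ^ 2 + 2 * (q.1.1 + q.2.1)| ^ ((1:ℝ)/2))) (fun q => G q.1) (fun q => F (q.1 + q.2)) (fun q => H q.2)
      (fun q => w (q.1.2 + q.2.2 + SchPhase (q.1.1 + q.2.1)) * w (q.2.2 + AiryPhase q.2.1))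
      (fun q => W (q.1.2 + q.2.2 + SchPhase (q.1.1 + q.2.1)) * W (q.2.2 + AiryPhase q.2.1))
      (by fun_prop) (by fun_prop) (by fun_prop) (by fun_prop) (by fun_prop) (by fun_prop)
      (fun q => hww _ _) _ _ _ _ ?_ ?_
    · simp_rw [hsq]
      rw [Measure.volume_eq_prod (ℝ × ℝ) (ℝ × ℝ), lintegral_prod _ (by fun_prop)]
      refine hfin G _ hG (fun p => by fun_prop) (fun p => ?_) hN
      have := kerB (fun x => ENNReal.ofReal |3 * x ^ 2 + 2 * (p.1 + x)|) (by fun_prop) w hw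
        (fun x => SchPhase (p.1 + x)) AiryPhase (by fun_prop) hA p.2 1 (by
          intro e
          convert oneD_cubic 1 1 (2 * p.1) (e + p.1 ^ 2) (by norm_num) w using 3 with x
          congr 2
          · congr 1; ring
          · simp only [SchPhase, AiryPhase]; ring)
      simpa using this
    · rw [← hshift _ _ (by fun_prop) (by fun_prop)]
      congr 1; ext q; simp only [Prod.fst_add, Prod.snd_add]; ring
  · have e0 : ∀ q : (ℝ × ℝ) × (ℝ × ℝ), ENNReal.ofReal (|q.2.1| ^ ((1:ℝ)/2))
        * F (q.1 + q.2) * G q.1 * H q.2 = ENNReal.ofReal (|q.2.1| ^ ((1:ℝ)/2))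
        * H q.2 * F (q.1 + q.2) * G q.1 := fun q => by ring
    simp_rw [e0]
    refine triCS (Q := (ℝ × ℝ) × (ℝ × ℝ)) volume
      (fun q => ENNReal.ofReal (|q.2.1| ^ ((1:ℝ)/2))) (fun q => H q.2) (fun q => F (q.1 + q.2)) (fun q => G q.1)
      (fun q => w (q.1.2 + q.2.2 + SchPhase (q.1.1 + q.2.1)) * w (q.1.2 + SchPhase q.1.1))
      (fun q => W (q.1.2 + q.2.2 + SchPhase (q.1.1 + q.2.1)) * W (q.1.2 + SchPhase q.1.1))
      (by fun_prop) (by fun_prop) (by fun_prop) (by fun_prop) (by fun_prop) (by fun_prop)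
      (fun q => hww _ _) _ _ _ _ ?_ ?_
    · simp_rw [hsq]
      rw [Measure.volume_eq_prod (ℝ × ℝ) (ℝ × ℝ), lintegral_prod_symm' _ (by fun_prop)]
      refine hfin H _ hH (fun p => by fun_prop) (fun p => ?_) hN
      have := kerB (fun x => ENNReal.ofReal |p.1|) (by fun_prop) w hw
        (fun x => SchPhase (x + p.1)) SchPhase (by fun_prop) hS p.2 1 (by
          intro e
          convert oneD_lin p.1 (e + p.1 ^ 2) w using 3 with x
          congr 1
          simp only [SchPhase]; ring)
      refine le_trans (le_of_eq ?_) this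
      congr 1; ext r; congr 4; ring
    · rw [← hshift2 _ _ (by fun_prop) (by fun_prop)]
      congr 1; ext q; simp only [Prod.fst_add, Prod.snd_add]; ring

/-- the trilinear estimates for `I^{1/2}_1`, `I^{1/2}_2`, `I^{1/2}_3`. -/
theorem stmt2 (ε : ℝ) (hε : 0 < ε) :
    ∃ C : ℝ, 0 < C ∧
      ∀ f g h : ℝ × ℝ → ℂ, HasNonnegFT f → HasNonnegFT g → HasNonnegFT h →
        (Itri (fun ξ₁ ξ₂ => |3 * ξ₂ ^ 2 + 2 * ξ₁| ^ ((1:ℝ)/2)) (FT2 f) (FT2 g) (FT2 h) ≤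
            ENNReal.ofReal C * eLpNorm f 2 volume * XNorm SchPhase 0 (1/2 + ε) g *
              XNorm AiryPhase 0 (1/2 + ε) h) ∧
        (Itri (fun ξ₁ ξ₂ => |3 * ξ₂ ^ 2 + 2 * (ξ₁ + ξ₂)| ^ ((1:ℝ)/2)) (FT2 f) (FT2 g) (FT2 h) ≤
            ENNReal.ofReal C * XNorm SchPhase 0 (1/2 + ε) f * eLpNorm g 2 volume *
              XNorm AiryPhase 0 (1/2 + ε) h) ∧
        (Itri (fun _ ξ₂ => |ξ₂| ^ ((1:ℝ)/2)) (FT2 f) (FT2 g) (FT2 h) ≤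
            ENNReal.ofReal C * XNorm SchPhase 0 (1/2 + ε) f * XNorm SchPhase 0 (1/2 + ε) g *
              eLpNorm h 2 volume) := by
  set b : ℝ := 1/2 + ε with hb
  set w : ℝ → ℝ≥0∞ := fun a => ENNReal.ofReal (jb a ^ (-(2 * b))) with hwdef
  set W : ℝ → ℝ≥0∞ := fun a => ENNReal.ofReal (jb a ^ (2 * b)) with hWdef
  have hw : Measurable w :=
    ENNReal.measurable_ofReal.comp (jb_cont.measurable.pow_const _)
  have hW : Measurable W :=
    ENNReal.measurable_ofReal.comp (jb_cont.measurable.pow_const _)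
  have hwW : ∀ a, w a * W a = 1 := by
    intro a
    rw [hwdef, hWdef]
    dsimp only
    rw [← ENNReal.ofReal_mul (Real.rpow_nonneg (jb_pos a).le _), ← Real.rpow_add (jb_pos a)]
    simp
  have hK : ∫⁻ x, w x ≠ ⊤ := jb_int ε hε
  set K : ℝ≥0∞ := (3 * (∫⁻ x, w x) * ∫⁻ x, w x) ^ (1/2 : ℝ) with hKdef
  have hKt : K ≠ ⊤ := by
    apply ENNReal.rpow_ne_top_of_nonneg (by norm_num)
    exact ENNReal.mul_ne_top (ENNReal.mul_ne_top (by norm_num) hK) hK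
  have hKC : K ≤ ENNReal.ofReal (K.toReal + 1) := by
    rw [← ENNReal.ofReal_toReal hKt]
    apply ENNReal.ofReal_le_ofReal
    rw [ENNReal.toReal_ofReal ENNReal.toReal_nonneg]
    linarith
  refine ⟨K.toReal + 1, by positivity, fun f g h hf hg hh => ?_⟩
  have mF : ∀ f : ℝ × ℝ → ℂ, Measurable fun p => ‖FT2 f p‖ₑ :=
    fun f => (FT2_cont f).enorm.measurable
  have key := fun N => main_i w W hw hW hwW _ _ _ (mF f) (mF g) (mF h) N
  rw [Itri_eq _ f g h (fun _ _ => by positivity) hf hg hh,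
    Itri_eq _ f g h (fun _ _ => by positivity) hf hg hh,
    Itri_eq _ f g h (fun _ _ => by positivity) hf hg hh]
  simp only [XNorm_eq]
  refine ⟨?_, ?_, ?_⟩
  · refine ((key _).1 (FT2_planch f)).trans ?_
    gcongr
  · refine ((key _).2.1 (FT2_planch g)).trans ?_
    rw [mul_right_comm K]
    gcongr
  · refine ((key _).2.2 (FT2_planch h)).trans ?_
    rw [mul_right_comm K, mul_right_comm (K * _)]
    gcongr

end
end

section
/- For every ε > 0 there exists a constant C > 0 such that for all f, g, h whose spacetime Fourier transforms f̂, ĝ, ĥ are nonnegative, I_{m}(f̂,ĝ,ĥ) ≤ C ‖f‖_{L²(ℝ²)} ‖g‖_{Y_{0,1/2+ε}} ‖h‖_{Y_{0,1/2+ε}} with weight m(ξ₁,ξ₂) = (|ξ₁−ξ₂| |ξ₁+ξ₂|)^{1/2}. -/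
open MeasureTheory Real Set
open scoped ENNReal NNReal

noncomputable section

open FourierTransform ContDiff SchwartzMap in
theorem my_planch {V : Type*} [NormedAddCommGroup V] [InnerProductSpace ℝ V] [FiniteDimensional ℝ V] [MeasurableSpace V] [BorelSpace V] (f : V → ℂ) (h1 : Integrable f) (h2 : MemLp f 2) :
    eLpNorm (𝓕 f) 2 volume = eLpNorm f 2 volume := by
  set u := 𝓕 (h2.toLp f) with hu
  have hcont : Continuous (𝓕 f) := VectorFourier.fourierIntegral_continuous Real.continuous_fourierChar continuous_inner h1
  have key : ∀ᵐ x : V, 𝓕 f x = (u : V → ℂ) x := by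
    apply ae_eq_of_integral_contDiff_smul_eq hcont.locallyIntegrable
    · exact (Lp.memLp u).locallyIntegrable (by norm_num)
    intro g hg hgc
    let g' : V → ℂ := fun x => (g x : ℂ)
    have hg' : ContDiff ℝ ∞ g' := Complex.ofRealCLM.contDiff.comp hg
    have hgc' : HasCompactSupport g' := hgc.comp_left (g := fun x : ℝ => (x : ℂ)) (by simp)
    let G : 𝓢(V, ℂ) := hgc'.toSchwartzMap hg'
    have e := congrArg (fun T => T G) (Lp.fourier_toTemperedDistribution_eq (h2.toLp f))
    simp only [TemperedDistribution.fourier_apply, Lp.toTemperedDistribution_apply] at e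
    have e1 : ∫ x, g x • (u : V → ℂ) x = ∫ x, G x • (u : V → ℂ) x := by
      congr 1
    have e2 : ∫ x, g x • 𝓕 f x = ∫ x, G x • 𝓕 f x := by
      congr 1
    rw [e1, e2, ← e]
    have e3 : ∫ x, (𝓕 G) x • (h2.toLp f : V → ℂ) x = ∫ x, (𝓕 G) x • f x := by
      apply integral_congr_ae
      filter_upwards [h2.coeFn_toLp] with x hx
      rw [hx]
    rw [e3]
    have := (VectorFourier.integral_fourierIntegral_smul_eq_flip (L := innerₗ V) (μ := volume) (ν := volume) (f := (G : V → ℂ)) (g := f) Real.continuous_fourierChar continuous_inner G.integrable h1)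
    rw [flip_innerₗ] at this
    exact this.symm
  rw [eLpNorm_congr_ae key, ← eLpNorm_congr_ae h2.coeFn_toLp]
  have := Lp.norm_fourier_eq (h2.toLp f)
  rw [Lp.norm_def, Lp.norm_def] at this
  exact (ENNReal.toReal_eq_toReal_iff' (Lp.eLpNorm_ne_top _) (Lp.eLpNorm_ne_top _)).1 this

open FourierTransform in
theorem my_ft2_eq (f : ℝ × ℝ → ℂ) (p : ℝ × ℝ) :
    FT2 f p = 𝓕 (fun v : WithLp 2 (ℝ × ℝ) => f v.ofLp) (WithLp.toLp 2 p) := by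
  rw [Real.fourier_eq']
  have := (WithLp.volume_preserving_ofLp ℝ ℝ).integral_comp (MeasurableEquiv.toLp 2 (ℝ × ℝ)).symm.measurableEmbedding
    (fun q : ℝ × ℝ => Complex.exp (-(2 * Real.pi * (q.1 * p.1 + q.2 * p.2)) * Complex.I) • f q)
  unfold FT2
  rw [← this]
  congr 1
  ext v
  congr 2
  simp [WithLp.prod_inner_apply]
  ring

open FourierTransform in
theorem my_ft2_cont (f : ℝ × ℝ → ℂ) (hf : Integrable f) : Continuous (FT2 f) := by
  have h1 : Integrable (fun v : WithLp 2 (ℝ × ℝ) => f v.ofLp) :=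
    (WithLp.volume_preserving_ofLp ℝ ℝ).integrable_comp_of_integrable hf
  have : Continuous (𝓕 (fun v : WithLp 2 (ℝ × ℝ) => f v.ofLp)) :=
    VectorFourier.fourierIntegral_continuous Real.continuous_fourierChar continuous_inner h1
  have h2 := this.comp (WithLp.prod_continuous_toLp 2 ℝ ℝ)
  convert! h2 using 1
  ext p
  exact my_ft2_eq f p

theorem my_ft2_zero (f : ℝ × ℝ → ℂ) (hf : ¬ Integrable f) : FT2 f = 0 := by
  ext p
  apply integral_undef
  intro h
  apply hf
  have hc : Continuous (fun q : ℝ × ℝ => Complex.exp ((2 * Real.pi * (q.1 * p.1 + q.2 * p.2)) * Complex.I)) := by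
    fun_prop
  have := h.bdd_mul (c := 1) hc.aestronglyMeasurable (Filter.Eventually.of_forall fun q => by
    have := Complex.norm_exp_ofReal_mul_I (2 * Real.pi * (q.1 * p.1 + q.2 * p.2))
    push_cast at this
    exact this.le)
  refine this.congr (Filter.Eventually.of_forall fun q => ?_)
  simp only [smul_eq_mul, ← mul_assoc, ← Complex.exp_add]
  ring_nf
  simp

theorem my_ft2_meas (f : ℝ × ℝ → ℂ) : Measurable (FT2 f) := by
  by_cases hf : Integrable f
  · exact (my_ft2_cont f hf).measurable
  · rw [my_ft2_zero f hf]; exact measurable_zero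

open FourierTransform in
theorem my_ft2_norm (f : ℝ × ℝ → ℂ) : eLpNorm (FT2 f) 2 volume ≤ eLpNorm f 2 volume := by
  by_cases hf : Integrable f
  swap
  · rw [my_ft2_zero f hf]; simp
  by_cases ht : eLpNorm f 2 volume = ⊤
  · rw [ht]; exact le_top
  have h2 : MemLp f 2 := ⟨hf.1, lt_top_iff_ne_top.2 ht⟩
  have mo := WithLp.volume_preserving_ofLp ℝ ℝ
  have mt := WithLp.volume_preserving_toLp ℝ ℝ
  have h1 : Integrable (fun v : WithLp 2 (ℝ × ℝ) => f v.ofLp) :=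
    mo.integrable_comp_of_integrable hf
  have h2' : MemLp (fun v : WithLp 2 (ℝ × ℝ) => f v.ofLp) 2 := h2.comp_measurePreserving mo
  have e := my_planch _ h1 h2'
  have e1 : eLpNorm (fun v : WithLp 2 (ℝ × ℝ) => f v.ofLp) 2 volume = eLpNorm f 2 volume :=
    eLpNorm_comp_measurePreserving hf.1 mo
  have hc : Continuous (𝓕 (fun v : WithLp 2 (ℝ × ℝ) => f v.ofLp)) :=
    VectorFourier.fourierIntegral_continuous Real.continuous_fourierChar continuous_inner h1
  have e2 := eLpNorm_comp_measurePreserving (p := 2) hc.aestronglyMeasurable mt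
  rw [← e1, ← e, ← e2]
  apply le_of_eq
  congr 1
  ext p
  exact my_ft2_eq f p

theorem my_A (W : ℝ → ℝ≥0∞) (ξ A : ℝ) :
    ∫⁻ s : ℝ, ENNReal.ofReal (|6 * ξ * s|) * W (A - 3 * ξ * s ^ 2) ≤ 2 * ∫⁻ a, W a := by
  rcases eq_or_ne ξ 0 with h0 | h0
  · simp [h0]
  have key : ∀ S : Set ℝ, MeasurableSet S → (∀ x ∈ S, ∀ y ∈ S, x ^ 2 = y ^ 2 → x = y) →
      ∫⁻ s in S, ENNReal.ofReal (|6 * ξ * s|) * W (A - 3 * ξ * s ^ 2) ≤ ∫⁻ a, W a := by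
    intro S hS hinj
    have := lintegral_image_eq_lintegral_abs_deriv_mul (f := fun s => A - 3 * ξ * s ^ 2)
      (f' := fun s => - (6 * ξ * s)) hS (fun x _ => by
        have h := (((hasDerivAt_pow 2 x).const_mul (3 * ξ)).const_sub A)
        refine (h.congr_deriv ?_).hasDerivWithinAt
        simp; ring) (fun x hx y hy hxy => hinj x hx y hy (by
          simp only [sub_right_inj] at hxy
          exact mul_left_cancel₀ (by simpa using h0) hxy)) W
    simp only [abs_neg] at this
    rw [← this]
    exact setLIntegral_le_lintegral _ _
  have hu : (Set.univ : Set ℝ) = Set.Ici 0 ∪ Set.Iic 0 := by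
    ext x; simp
  rw [← setLIntegral_univ, hu, two_mul]
  refine (lintegral_union_le _ _ _).trans (add_le_add (key _ measurableSet_Ici ?_) (key _ measurableSet_Iic ?_))
  · intro x hx y hy h
    exact (sq_eq_sq₀ hx hy).1 h
  · intro x hx y hy h
    have hx : x ≤ 0 := hx
    have hy : y ≤ 0 := hy
    have := (sq_eq_sq₀ (neg_nonneg.2 hx) (neg_nonneg.2 hy)).1 (by simpa using h)
    linarith

theorem my_B (W : ℝ → ℝ≥0∞) (hW : Measurable W) (ξ τ : ℝ) :
    ∫⁻ p : ℝ × ℝ, ENNReal.ofReal (|p.1 - (ξ - p.1)| * |ξ|) *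
      (W (p.2 - p.1 ^ 3) * W (τ - p.2 - (ξ - p.1) ^ 3)) ≤ 2 * (∫⁻ a, W a) ^ 2 := by
  have hm : Measurable (fun p : ℝ × ℝ => ENNReal.ofReal (|p.1 - (ξ - p.1)| * |ξ|) *
      (W (p.2 - p.1 ^ 3) * W (τ - p.2 - (ξ - p.1) ^ 3))) := by fun_prop
  have hm2 : Measurable (fun p : ℝ × ℝ => ENNReal.ofReal (|p.1 - (ξ - p.1)| * |ξ|) *
      (W p.2 * W (τ - p.2 - p.1 ^ 3 - (ξ - p.1) ^ 3))) := by fun_prop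
  rw [Measure.volume_eq_prod, lintegral_prod _ hm.aemeasurable]
  calc _ = ∫⁻ x : ℝ, ∫⁻ a : ℝ, ENNReal.ofReal (|x - (ξ - x)| * |ξ|) *
      (W a * W (τ - a - x ^ 3 - (ξ - x) ^ 3)) := by
        congr 1
        ext x
        rw [← lintegral_add_right_eq_self _ (x ^ 3)]
        refine lintegral_congr fun a => ?_
        have e1 : a + x ^ 3 - x ^ 3 = a := by ring
        have e2 : τ - (a + x ^ 3) - (ξ - x) ^ 3 = τ - a - x ^ 3 - (ξ - x) ^ 3 := by ring
        simp only [e1, e2]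
    _ = ∫⁻ a : ℝ, ∫⁻ x : ℝ, ENNReal.ofReal (|x - (ξ - x)| * |ξ|) *
      (W a * W (τ - a - x ^ 3 - (ξ - x) ^ 3)) := lintegral_lintegral_swap hm2.aemeasurable
    _ ≤ ∫⁻ a : ℝ, W a * (2 * ∫⁻ a, W a) := by
        apply lintegral_mono
        intro a
        calc _ = ∫⁻ x : ℝ, W a * (ENNReal.ofReal (|x - (ξ - x)| * |ξ|) *
                W (τ - a - x ^ 3 - (ξ - x) ^ 3)) := by
                  refine lintegral_congr fun x => ?_; ring
          _ = W a * ∫⁻ x : ℝ, (ENNReal.ofReal (|x - (ξ - x)| * |ξ|) *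
                W (τ - a - x ^ 3 - (ξ - x) ^ 3)) := by
                  rw [lintegral_const_mul]
                  fun_prop
          _ ≤ _ := by
            refine mul_le_mul' le_rfl ?_
            rw [← lintegral_add_right_eq_self _ (ξ / 2)]
            refine le_trans ?_ (my_A W ξ (τ - a - ξ ^ 3 / 4))
            apply lintegral_mono
            intro s
            have e : τ - a - (s + ξ / 2) ^ 3 - (ξ - (s + ξ / 2)) ^ 3 = τ - a - ξ ^ 3 / 4 - 3 * ξ * s ^ 2 := by
              ring
            simp only [e]
            gcongr
            rw [← abs_mul]
            have : (s + ξ / 2 - (ξ - (s + ξ / 2))) * ξ = (6 * ξ * s) / 3 := by ring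
            rw [this, abs_div]
            have := abs_nonneg (6 * ξ * s)
            rw [abs_of_pos (by norm_num : (0:ℝ) < 3)]
            linarith
    _ = _ := by
        rw [lintegral_mul_const _ hW]; ring

theorem my_core (w : ℝ → ℝ≥0∞) (hw : Measurable w) (hw0 : ∀ a, w a ≠ 0) (hwt : ∀ a, w a ≠ ⊤)
    (F G H : ℝ × ℝ → ℝ≥0∞) (hF : Measurable F) (hG : Measurable G) (hH : Measurable H) :
    ∫⁻ q : (ℝ × ℝ) × (ℝ × ℝ), ENNReal.ofReal ((|q.1.1 - q.2.1| * |q.1.1 + q.2.1|) ^ ((1:ℝ)/2)) *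
      F (q.1 + q.2) * G q.1 * H q.2 ≤
    (2 * (∫⁻ a, ((w a)⁻¹) ^ 2) ^ 2 * ∫⁻ p, F p ^ 2) ^ (1/2:ℝ) *
    ((∫⁻ p : ℝ × ℝ, (w (p.2 - p.1 ^ 3) * G p) ^ 2) * (∫⁻ p : ℝ × ℝ, (w (p.2 - p.1 ^ 3) * H p) ^ 2)) ^ (1/2:ℝ) := by
  let a : (ℝ × ℝ) × (ℝ × ℝ) → ℝ≥0∞ := fun q =>
    ENNReal.ofReal ((|q.1.1 - q.2.1| * |q.1.1 + q.2.1|) ^ ((1:ℝ)/2)) *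
      F (q.1 + q.2) * ((w (q.1.2 - q.1.1 ^ 3))⁻¹ * (w (q.2.2 - q.2.1 ^ 3))⁻¹)
  let b : (ℝ × ℝ) × (ℝ × ℝ) → ℝ≥0∞ := fun q =>
    (w (q.1.2 - q.1.1 ^ 3) * G q.1) * (w (q.2.2 - q.2.1 ^ 3) * H q.2)
  have ha : Measurable a := by fun_prop
  have hb : Measurable b := by fun_prop
  have hab : ∀ q, ENNReal.ofReal ((|q.1.1 - q.2.1| * |q.1.1 + q.2.1|) ^ ((1:ℝ)/2)) *
      F (q.1 + q.2) * G q.1 * H q.2 = (a * b) q := by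
    intro q
    simp only [a, b, Pi.mul_apply]
    have h1 := ENNReal.inv_mul_cancel (hw0 (q.1.2 - q.1.1 ^ 3)) (hwt _)
    have h2 := ENNReal.inv_mul_cancel (hw0 (q.2.2 - q.2.1 ^ 3)) (hwt _)
    generalize ENNReal.ofReal ((|q.1.1 - q.2.1| * |q.1.1 + q.2.1|) ^ ((1:ℝ)/2)) = M at *
    generalize w (q.1.2 - q.1.1 ^ 3) = x at *
    generalize w (q.2.2 - q.2.1 ^ 3) = y at *
    calc _ = M * F (q.1 + q.2) * G q.1 * H q.2 * (x⁻¹ * x) * (y⁻¹ * y) := by rw [h1, h2]; simp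
      _ = _ := by ring
  simp only [hab]
  refine (ENNReal.lintegral_mul_le_Lp_mul_Lq volume Real.HolderConjugate.two_two ha.aemeasurable hb.aemeasurable).trans ?_
  simp only [ENNReal.rpow_ofNat]
  refine mul_le_mul' (ENNReal.rpow_le_rpow ?_ (by norm_num)) (ENNReal.rpow_le_rpow ?_ (by norm_num))
  · have ha2 : Measurable (fun q => a q ^ 2) := by fun_prop
    have hWm : Measurable (fun a => ((w a)⁻¹) ^ 2) := by fun_prop
    rw [Measure.volume_eq_prod, lintegral_prod _ ha2.aemeasurable]
    let c : ℝ × ℝ → ℝ × ℝ → ℝ≥0∞ := fun p r =>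
      F r ^ 2 * (ENNReal.ofReal (|p.1 - (r.1 - p.1)| * |r.1|) *
      (((w (p.2 - p.1 ^ 3))⁻¹) ^ 2 * ((w (r.2 - p.2 - (r.1 - p.1) ^ 3))⁻¹) ^ 2))
    have hc : Measurable (Function.uncurry c) := by
      simp only [c, Function.uncurry_def]
      fun_prop
    calc _ = ∫⁻ p : ℝ × ℝ, ∫⁻ r : ℝ × ℝ, c p r := by
          congr 1
          ext p
          rw [← lintegral_sub_right_eq_self _ p]
          congr 1
          ext r
          simp only [a, c, mul_pow, Prod.fst_sub, Prod.snd_sub, add_sub_cancel]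
          have : ENNReal.ofReal ((|p.1 - (r.1 - p.1)| * |r.1|) ^ ((1:ℝ)/2)) ^ 2 = ENNReal.ofReal (|p.1 - (r.1 - p.1)| * |r.1|) := by
            rw [← ENNReal.ofReal_pow (by positivity), ← Real.sqrt_eq_rpow, Real.sq_sqrt (by positivity)]
          rw [this]
          ring
      _ = ∫⁻ r : ℝ × ℝ, ∫⁻ p : ℝ × ℝ, c p r := lintegral_lintegral_swap hc.aemeasurable
      _ ≤ ∫⁻ r : ℝ × ℝ, F r ^ 2 * (2 * (∫⁻ a, ((w a)⁻¹) ^ 2) ^ 2) := by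
          apply lintegral_mono
          intro r
          simp only [c]
          rw [lintegral_const_mul _ (by fun_prop)]
          gcongr
          exact my_B (fun a => ((w a)⁻¹) ^ 2) hWm r.1 r.2
      _ = _ := by
          rw [lintegral_mul_const _ (by fun_prop)]; ring
  · apply le_of_eq
    simp only [b, mul_pow (w _ * G _)]
    rw [Measure.volume_eq_prod, ← lintegral_prod_mul (by fun_prop) (by fun_prop)]

theorem my_X (b : ℝ) (g : ℝ × ℝ → ℂ) (hg : HasNonnegFT g) :
    XNorm AiryPhase 0 b g = (∫⁻ p : ℝ × ℝ, (ENNReal.ofReal (jb (p.2 - p.1 ^ 3) ^ b) *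
      ENNReal.ofReal (FT2 g p).re) ^ 2) ^ (1/2:ℝ) := by
  unfold XNorm
  congr 1
  refine lintegral_congr fun p => ?_
  have hj : 0 ≤ jb (p.2 - p.1 ^ 3) := Real.sqrt_nonneg _
  have hn : ‖FT2 g p‖ = (FT2 g p).re := by
    have : FT2 g p = ((FT2 g p).re : ℂ) := Complex.ext rfl (by simpa using (hg p).1)
    rw [this, Complex.norm_real]
    simpa using (hg p).2
  rw [← ENNReal.ofReal_mul (Real.rpow_nonneg hj _), ← ENNReal.ofReal_pow (mul_nonneg (Real.rpow_nonneg hj _) (hg p).2), hn]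
  congr 1
  have : p.2 + AiryPhase p.1 = p.2 - p.1 ^ 3 := by simp [AiryPhase]; ring
  rw [this, mul_pow, mul_zero, Real.rpow_zero, one_mul, mul_comm 2 b, Real.rpow_mul hj]
  simp

theorem my_K (ε : ℝ) (hε : 0 < ε) :
    ∫⁻ a, ((ENNReal.ofReal (jb a ^ (1/2 + ε)))⁻¹) ^ 2 ≠ ⊤ := by
  have h := integrable_rpow_neg_one_add_norm_sq (E := ℝ) (μ := volume) (r := 1 + 2 * ε)
    (by simp; linarith)
  have h2 := h.lintegral_lt_top
  refine ne_of_eq_of_ne (lintegral_congr fun a => ?_) h2.ne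
  have hp : 0 < 1 + a ^ 2 := by positivity
  have hj : 0 < jb a := Real.sqrt_pos.2 hp
  rw [← ENNReal.ofReal_inv_of_pos (Real.rpow_pos_of_pos hj _), ← ENNReal.ofReal_pow (by positivity)]
  congr 1
  unfold jb
  rw [Real.sqrt_eq_rpow, ← Real.rpow_mul hp.le, ← Real.rpow_neg hp.le, ← Real.rpow_natCast,
    ← Real.rpow_mul hp.le]
  simp only [Real.norm_eq_abs, sq_abs]
  congr 1
  push_cast
  ring

/-- the trilinear estimate for `I^{1/2}_7`. -/
theorem stmt4 (ε : ℝ) (hε : 0 < ε) :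
    ∃ C : ℝ, 0 < C ∧
      ∀ f g h : ℝ × ℝ → ℂ, HasNonnegFT f → HasNonnegFT g → HasNonnegFT h →
        Itri (fun ξ₁ ξ₂ => (|ξ₁ - ξ₂| * |ξ₁ + ξ₂|) ^ ((1:ℝ)/2)) (FT2 f) (FT2 g) (FT2 h) ≤
          ENNReal.ofReal C * eLpNorm f 2 volume * XNorm AiryPhase 0 (1/2 + ε) g *
            XNorm AiryPhase 0 (1/2 + ε) h := by
  set w : ℝ → ℝ≥0∞ := fun a => ENNReal.ofReal (jb a ^ (1/2 + ε)) with hwdef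
  have hj : ∀ a, 0 < jb a := fun a => Real.sqrt_pos.2 (by positivity)
  have hw : Measurable w := by
    have : Measurable jb := by unfold jb; fun_prop
    fun_prop
  set K := ∫⁻ a, ((w a)⁻¹) ^ 2 with hK
  have hKt : K ≠ ⊤ := my_K ε hε
  refine ⟨2 * K.toReal + 1, by positivity, fun f g h hf hg hh => ?_⟩
  have mre : ∀ f, Measurable (fun p => ENNReal.ofReal (FT2 f p).re) := fun f =>
    (Complex.measurable_re.comp (my_ft2_meas f)).ennreal_ofReal
  have core := my_core w hw (fun a => (ENNReal.ofReal_pos.2 (Real.rpow_pos_of_pos (hj a) _)).ne')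
    (fun a => ENNReal.ofReal_ne_top) _ _ _ (mre f) (mre g) (mre h)
  have e : Itri (fun ξ₁ ξ₂ => (|ξ₁ - ξ₂| * |ξ₁ + ξ₂|) ^ ((1:ℝ)/2)) (FT2 f) (FT2 g) (FT2 h) =
      ∫⁻ q : (ℝ × ℝ) × (ℝ × ℝ), ENNReal.ofReal ((|q.1.1 - q.2.1| * |q.1.1 + q.2.1|) ^ ((1:ℝ)/2)) *
      ENNReal.ofReal (FT2 f (q.1 + q.2)).re * ENNReal.ofReal (FT2 g q.1).re *
      ENNReal.ofReal (FT2 h q.2).re := by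
    unfold Itri
    refine lintegral_congr fun q => ?_
    have h1 : 0 ≤ (|q.1.1 - q.2.1| * |q.1.1 + q.2.1|) ^ ((1:ℝ)/2) := by positivity
    have h2 := (hf (q.1 + q.2)).2
    have h3 := (hg q.1).2
    rw [← ENNReal.ofReal_mul h1, ← ENNReal.ofReal_mul (mul_nonneg h1 h2),
      ← ENNReal.ofReal_mul (mul_nonneg (mul_nonneg h1 h2) h3)]
    rfl
  rw [e]
  refine core.trans ?_
  rw [my_X _ g hg, my_X _ h hh,
    ENNReal.mul_rpow_of_nonneg (2 * _) _ (by norm_num : (0:ℝ) ≤ 1/2),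
    ENNReal.mul_rpow_of_nonneg (lintegral _ _) _ (by norm_num : (0:ℝ) ≤ 1/2), ← mul_assoc]
  refine mul_le_mul' (mul_le_mul' (mul_le_mul' ?_ ?_) le_rfl) le_rfl
  · calc (2 * K ^ 2) ^ (1/2:ℝ) ≤ ((2 * K) ^ 2) ^ (1/2:ℝ) := by
          apply ENNReal.rpow_le_rpow _ (by norm_num)
          rw [mul_pow]
          gcongr
          norm_num
      _ = 2 * K := by
          rw [← ENNReal.rpow_natCast, ← ENNReal.rpow_mul]; norm_num
      _ ≤ _ := by
          rw [ENNReal.ofReal_add (by positivity) (by norm_num), ENNReal.ofReal_mul (by norm_num),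
            ENNReal.ofReal_toReal hKt]
          simp
  · refine le_trans ?_ (my_ft2_norm f)
    rw [eLpNorm_eq_lintegral_rpow_enorm_toReal (by norm_num) (by norm_num)]
    simp only [ENNReal.toReal_ofNat, ENNReal.rpow_ofNat]
    apply ENNReal.rpow_le_rpow _ (by norm_num)
    apply lintegral_mono
    intro p
    beta_reduce
    gcongr
    rw [← ofReal_norm_eq_enorm]
    exact ENNReal.ofReal_le_ofReal (Complex.re_le_norm _)

end
end
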